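/- Let μ be a finite Borel measure on ℝ³ with compact support S. Then the single-layer (Newtonian) potential p(x) = ∫ 1/(4π ‖x - y‖) dμ(y) is well defined for every x ∉ S and is harmonic on the open set ℝ³ \ S, i.e., p is twice continuously differentiable there and ∂²p/∂x₁² + ∂²p/∂x₂² + ∂²p/∂x₃² = 0 at every x ∉ S. -/

import Mathlib

open Real MeasureTheory

section ConvolutionKernel

open Set Topology

variable {E F : Type*} [NormedAddCommGroup E] [MeasurableSpace E] [BorelSpace E]
  [NormedAddCommGroup F]
  {μ : Measure E} {S : Set E} {k : E → F}

/-- If `k` is continuous away from the origin and `μ` is a finite measure carried by a compact set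
`S`, then `y ↦ k (x - y)` is `μ`-integrable for every `x ∉ S`. -/
theorem integrable_comp_sub_of_isCompact [IsFiniteMeasure μ] (hS : IsCompact S)
    (hnull : μ Sᶜ = 0) (hk : ContinuousOn k {0}ᶜ) {x : E} (hx : x ∉ S) :
    Integrable (fun y => k (x - y)) μ := by
  have hcont : ContinuousOn (fun y => k (x - y)) S := by
    refine hk.comp (by fun_prop) fun y hy => ?_
    rintro h0
    exact hx (sub_eq_zero.1 h0 ▸ hy)
  have hint : IntegrableOn (fun y => k (x - y)) S μ := hcont.integrableOn_compact hS
  rwa [IntegrableOn, Measure.restrict_eq_self_of_ae_mem (mem_ae_iff.2 hnull)] at hint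

variable [NormedSpace ℝ E] [NormedSpace ℝ F]

/-- Differentiation under the integral sign for `x ↦ ∫ y, k (x - y) ∂μ` away from the compact set
carrying `μ`, when `k` is continuously differentiable away from the origin. -/
theorem hasFDerivAt_integral_comp_sub [IsFiniteMeasure μ] [ProperSpace E] (hS : IsCompact S)
    (hnull : μ Sᶜ = 0) (hk : ContDiffOn ℝ 1 k {0}ᶜ) {x : E} (hx : x ∉ S) :
    HasFDerivAt (fun x => ∫ y, k (x - y) ∂μ) (∫ y, fderiv ℝ k (x - y) ∂μ) x := by
  have hk' : ContinuousOn (fderiv ℝ k) {0}ᶜ :=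
    hk.continuousOn_fderiv_of_isOpen isOpen_compl_singleton le_rfl
  obtain ⟨δ, hδ, hball⟩ := Metric.nhds_basis_closedBall.mem_iff.1
    (hS.isClosed.isOpen_compl.mem_nhds hx)
  have hne : ∀ z ∈ Metric.closedBall x δ, ∀ y ∈ S, z - y ∈ ({0}ᶜ : Set E) := by
    intro z hz y hy h0
    exact hball hz (sub_eq_zero.1 h0 ▸ hy)
  have hK : IsCompact ((fun p : E × E => p.1 - p.2) '' (Metric.closedBall x δ ×ˢ S)) :=
    ((isCompact_closedBall x δ).prod hS).image (by fun_prop)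
  obtain ⟨C, hC⟩ := hK.exists_bound_of_continuousOn (hk'.mono (by
    rintro _ ⟨⟨z, y⟩, ⟨hz, hy⟩, rfl⟩
    exact hne z hz y hy))
  have hae : ∀ᵐ y ∂μ, y ∈ S := mem_ae_iff.2 hnull
  refine hasFDerivAt_integral_of_dominated_of_fderiv_le (bound := fun _ => C)
    (F' := fun z y => fderiv ℝ k (z - y)) (Metric.closedBall_mem_nhds x hδ) ?_
    (integrable_comp_sub_of_isCompact hS hnull hk.continuousOn hx)
    (integrable_comp_sub_of_isCompact hS hnull hk' hx).aestronglyMeasurable ?_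
    (integrable_const C) ?_
  · filter_upwards [hS.isClosed.isOpen_compl.mem_nhds hx] with z hz
    exact (integrable_comp_sub_of_isCompact hS hnull hk.continuousOn hz).aestronglyMeasurable
  · filter_upwards [hae] with y hy z hz
    exact hC _ ⟨(z, y), ⟨hz, hy⟩, rfl⟩
  · filter_upwards [hae] with y hy z hz
    have hd : DifferentiableAt ℝ k (z - y) :=
      (hk.differentiableOn one_ne_zero).differentiableAt
        (isOpen_compl_singleton.mem_nhds (hne z hz y hy))
    exact (hasFDerivAt_comp_sub y).2 hd.hasFDerivAt

/-- The directional derivative of `x ↦ ∫ y, k (x - y) ∂μ` away from the compact set carrying `μ`. -/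
theorem fderiv_integral_comp_sub_apply [IsFiniteMeasure μ] [ProperSpace E] (hS : IsCompact S)
    (hnull : μ Sᶜ = 0) (hk : ContDiffOn ℝ 1 k {0}ᶜ) {x : E} (hx : x ∉ S) (v : E) :
    fderiv ℝ (fun x => ∫ y, k (x - y) ∂μ) x v = ∫ y, fderiv ℝ k (x - y) v ∂μ := by
  rw [(hasFDerivAt_integral_comp_sub hS hnull hk hx).fderiv]
  exact ContinuousLinearMap.integral_apply (integrable_comp_sub_of_isCompact hS hnull
    (hk.continuousOn_fderiv_of_isOpen isOpen_compl_singleton le_rfl) hx) v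

end ConvolutionKernel

/-- If `k` is of class `C^(n+1)` away from the origin and `μ` is a finite measure carried by a
compact set `S`, then `x ↦ ∫ y, k (x - y) ∂μ` is of class `C^n` on `Sᶜ`. -/
theorem contDiffOn_integral_comp_sub.{u} {E F : Type u} [NormedAddCommGroup E] [NormedSpace ℝ E]
    [MeasurableSpace E] [BorelSpace E] [ProperSpace E] [NormedAddCommGroup F] [NormedSpace ℝ F]
    {μ : Measure E} [IsFiniteMeasure μ] {S : Set E} (hS : IsCompact S) (hnull : μ Sᶜ = 0)
    {k : E → F} (n : ℕ) (hk : ContDiffOn ℝ (n + 1) k {0}ᶜ) :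
    ContDiffOn ℝ n (fun x => ∫ y, k (x - y) ∂μ) Sᶜ := by
  have hderiv : ∀ x ∈ Sᶜ, HasFDerivAt (fun x => ∫ y, k (x - y) ∂μ)
      (∫ y, fderiv ℝ k (x - y) ∂μ) x := fun x hx =>
    hasFDerivAt_integral_comp_sub hS hnull (hk.of_le le_add_self) hx
  induction n generalizing F with
  | zero =>
    exact contDiffOn_zero.2 fun x hx => (hderiv x hx).continuousAt.continuousWithinAt
  | succ n ih =>
    have hk' : ContDiffOn ℝ (n + 1) (fderiv ℝ k) {0}ᶜ :=
      hk.fderiv_of_isOpen isOpen_compl_singleton (by push_cast; exact le_rfl)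
    push_cast
    refine (contDiffOn_succ_iff_fderiv_of_isOpen hS.isClosed.isOpen_compl).2
      ⟨fun x hx => (hderiv x hx).differentiableAt.differentiableWithinAt, by simp, ?_⟩
    exact (ih hk' fun x hx =>
      hasFDerivAt_integral_comp_sub hS hnull (hk'.of_le le_add_self) hx).congr
      fun x hx => (hderiv x hx).fderiv

section NewtonianKernel

open scoped InnerProductSpace

variable {E : Type*} [NormedAddCommGroup E] [InnerProductSpace ℝ E]

/-- The Newtonian kernel is smooth away from the origin. -/
theorem contDiffOn_newtonian_kernel {n : WithTop ℕ∞} :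
    ContDiffOn ℝ n (fun z : E => 1 / (4 * π * ‖z‖)) {0}ᶜ := by
  refine contDiffOn_const.div (contDiffOn_const.mul (contDiffOn_id.norm ℝ fun z hz => hz)) ?_
  intro z hz
  have : ‖z‖ ≠ 0 := norm_ne_zero_iff.2 hz
  have := pi_ne_zero
  positivity

theorem hasFDerivAt_norm_of_ne_zero {z : E} (hz : z ≠ 0) :
    HasFDerivAt (fun z : E => ‖z‖) (‖z‖⁻¹ • innerSL ℝ z) z := by
  have h0 : ‖z‖ ≠ 0 := norm_ne_zero_iff.2 hz
  have h := (hasStrictFDerivAt_norm_sq z).hasFDerivAt.sqrt (pow_ne_zero 2 h0)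
  simp only [sqrt_sq (norm_nonneg _)] at h
  convert h using 1
  ext v
  simp
  field_simp

theorem fderiv_newtonian_kernel_apply {z : E} (hz : z ≠ 0) (v : E) :
    fderiv ℝ (fun z : E => 1 / (4 * π * ‖z‖)) z v = -(⟪z, v⟫_ℝ / (4 * π * ‖z‖ ^ 3)) := by
  have h0 : ‖z‖ ≠ 0 := norm_ne_zero_iff.2 hz
  have hpi := pi_ne_zero
  have h := ((hasDerivAt_inv (x := 4 * π * ‖z‖) (by positivity)).comp_hasFDerivAt z
    ((hasFDerivAt_norm_of_ne_zero hz).const_mul (4 * π)))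
  simp only [Function.comp_def, ← one_div] at h
  rw [h.fderiv]
  simp
  field_simp

theorem fderiv_fderiv_newtonian_kernel_apply {z : E} (hz : z ≠ 0) (v : E) :
    fderiv ℝ (fun z : E => fderiv ℝ (fun z : E => 1 / (4 * π * ‖z‖)) z v) z v =
      (3 * ⟪z, v⟫_ℝ ^ 2 - ‖z‖ ^ 2 * ‖v‖ ^ 2) / (4 * π * ‖z‖ ^ 5) := by
  have h0 : ‖z‖ ≠ 0 := norm_ne_zero_iff.2 hz
  have hpi := pi_ne_zero
  have heq : (fun z : E => fderiv ℝ (fun z : E => 1 / (4 * π * ‖z‖)) z v) =ᶠ[nhds z]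
      fun z => -(⟪z, v⟫_ℝ * (4 * π * ‖z‖ ^ 3)⁻¹) := by
    filter_upwards [isOpen_compl_singleton.mem_nhds hz] with w hw
    rw [fderiv_newtonian_kernel_apply hw, div_eq_mul_inv]
  have hinv := (hasDerivAt_inv (x := 4 * π * ‖z‖ ^ 3) (by positivity)).comp_hasFDerivAt z
    (((hasFDerivAt_norm_of_ne_zero hz).pow 3).const_mul (4 * π))
  have hinner : HasFDerivAt (fun z : E => ⟪z, v⟫_ℝ) (innerSL ℝ v) z := by
    simpa [real_inner_comm] using (innerSL ℝ v).hasFDerivAt (x := z)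
  have h := (hinner.mul hinv).neg.fderiv
  simp only [Function.comp_def, Pi.mul_def, Pi.neg_def] at h
  rw [heq.fderiv_eq, h]
  simp
  field_simp
  ring

/-- The Newtonian kernel on `ℝ³` is harmonic away from the origin. -/
theorem sum_fderiv_fderiv_newtonian_kernel {z : EuclideanSpace ℝ (Fin 3)} (hz : z ≠ 0) :
    ∑ i : Fin 3, fderiv ℝ (fun z : EuclideanSpace ℝ (Fin 3) =>
      fderiv ℝ (fun z : EuclideanSpace ℝ (Fin 3) => 1 / (4 * π * ‖z‖)) z
        (EuclideanSpace.single i (1 : ℝ))) z (EuclideanSpace.single i (1 : ℝ)) = 0 := by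
  simp only [fderiv_fderiv_newtonian_kernel_apply hz, ← Finset.sum_div]
  rw [div_eq_zero_iff]
  left
  simp [Fin.sum_univ_three, EuclideanSpace.real_norm_sq_eq, EuclideanSpace.inner_single_right]

end NewtonianKernel

/-- Single-layer (Newtonian) potential of a finite compactly supported Borel
measure `μ` on `ℝ³`: `p x = ∫ 1/(4π ‖x - y‖) dμ(y)` is well defined
(the integrand is `μ`-integrable) for every `x ∉ S`, where `S` is the compact
support of `μ` (the smallest closed set with null complement), `p` is twice
continuously differentiable on `ℝ³ \ S`, and the sum of its unmixed second
partial derivatives vanishes at every `x ∉ S`. -/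
theorem single_layer_newtonian_potential_harmonic
    (μ : Measure (EuclideanSpace ℝ (Fin 3))) [IsFiniteMeasure μ]
    (S : Set (EuclideanSpace ℝ (Fin 3))) (hS : IsCompact S) (hnull : μ Sᶜ = 0)
    (hmin : ∀ F : Set (EuclideanSpace ℝ (Fin 3)), IsClosed F → μ Fᶜ = 0 → S ⊆ F) :
    (∀ x ∉ S,
      Integrable (fun y : EuclideanSpace ℝ (Fin 3) =>
        1 / (4 * π * ‖x - y‖)) μ) ∧
    ContDiffOn ℝ 2
      (fun x : EuclideanSpace ℝ (Fin 3) =>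
        ∫ y, 1 / (4 * π * ‖x - y‖) ∂μ) Sᶜ ∧
    ∀ x ∉ S,
      (∑ i : Fin 3,
        fderiv ℝ
          (fun z : EuclideanSpace ℝ (Fin 3) =>
            fderiv ℝ
              (fun w : EuclideanSpace ℝ (Fin 3) =>
                ∫ y, 1 / (4 * π * ‖w - y‖) ∂μ)
              z (EuclideanSpace.single i (1 : ℝ)))
          x (EuclideanSpace.single i (1 : ℝ))) = 0 := by
  have hint : ∀ x ∉ S, Integrable (fun y : EuclideanSpace ℝ (Fin 3) => 1 / (4 * π * ‖x - y‖)) μ :=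
    fun x hx => integrable_comp_sub_of_isCompact
      (k := fun z : EuclideanSpace ℝ (Fin 3) => 1 / (4 * π * ‖z‖)) hS hnull
      (contDiffOn_newtonian_kernel (n := 0)).continuousOn hx
  refine ⟨hint, contDiffOn_integral_comp_sub
    (k := fun z : EuclideanSpace ℝ (Fin 3) => 1 / (4 * π * ‖z‖)) hS hnull 2
    contDiffOn_newtonian_kernel, fun x hx => ?_⟩
  have hk (v : EuclideanSpace ℝ (Fin 3)) : ContDiffOn ℝ 2 (fun z => fderiv ℝ
      (fun z : EuclideanSpace ℝ (Fin 3) => 1 / (4 * π * ‖z‖)) z v) {0}ᶜ :=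
    ((contDiffOn_newtonian_kernel (n := 3)).fderiv_of_isOpen isOpen_compl_singleton
      (by norm_num)).clm_apply contDiffOn_const
  have hsecond (v : EuclideanSpace ℝ (Fin 3)) :
      fderiv ℝ (fun z => fderiv ℝ (fun w => ∫ y, 1 / (4 * π * ‖w - y‖) ∂μ) z v) x v =
      ∫ y, fderiv ℝ (fun z => fderiv ℝ
        (fun z : EuclideanSpace ℝ (Fin 3) => 1 / (4 * π * ‖z‖)) z v) (x - y) v ∂μ := by
    rw [← fderiv_integral_comp_sub_apply hS hnull ((hk v).of_le one_le_two) hx v]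
    congr 1
    refine Filter.EventuallyEq.fderiv_eq ?_
    filter_upwards [hS.isClosed.isOpen_compl.mem_nhds hx] with z hz
    exact fderiv_integral_comp_sub_apply
      (k := fun z : EuclideanSpace ℝ (Fin 3) => 1 / (4 * π * ‖z‖)) hS hnull
      contDiffOn_newtonian_kernel hz v
  simp only [hsecond]
  rw [← integral_finsetSum]
  · refine integral_eq_zero_of_ae ?_
    filter_upwards [mem_ae_iff.2 hnull] with y hy
    exact sum_fderiv_fderiv_newtonian_kernel (sub_ne_zero.2 fun h => hx (h ▸ hy))
  · intro i _
    exact integrable_comp_sub_of_isCompact (k := fun w => fderiv ℝ (fun z => fderiv ℝ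
        (fun z : EuclideanSpace ℝ (Fin 3) => 1 / (4 * π * ‖z‖)) z (EuclideanSpace.single i 1)) w
          (EuclideanSpace.single i 1)) hS hnull
      (((hk _).continuousOn_fderiv_of_isOpen isOpen_compl_singleton one_le_two).clm_apply
        continuousOn_const) hx
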